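/- arXiv:1207.6279 — 9 statements merged into one kernel-verified Lean document; each statement's English description precedes it below -/
import Mathlib

section
/- Let m ≥ 2, k ≥ 1, let λ₁, …, λ_m be reals and Λ = diag(λ₁ I_k, …, λ_m I_k). Let D ∈ ℝ^{km×km} be invertible with first block row (I_k, I_k, …, I_k) (i.e. D₁₁ = I_k and D₁₂ = (I_k I_k ⋯ I_k)), and suppose H = Dᵀ D is block diagonal, H = diag(h₁, …, h_m) with each h_i ∈ ℝ^{k×k} invertible. Let A = D Λ D⁻¹ and let A₁₁ ∈ ℝ^{k×k} be its top-left k×k block. Then A₁₁ = Σ_{i=1}^{m} λ_i h_i⁻¹. -/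
/-- Block diagonal matrices with inverse diagonal blocks are inverse to each other. -/
lemma blockwise_mul_eq_one {ι n : Type*} [Fintype ι] [DecidableEq ι] [Fintype n] [DecidableEq n]
    {g h : ι → Matrix n n ℝ} (hgh : ∀ i, g i * h i = 1) :
    (Matrix.of fun (p q : ι × n) => if p.1 = q.1 then g p.1 p.2 q.2 else 0) *
      (Matrix.of fun (p q : ι × n) => if p.1 = q.1 then h p.1 p.2 q.2 else 0) = 1 := by
  ext ⟨i, a⟩ ⟨j, b⟩
  have key := congrFun (congrFun (hgh i) a) b
  rw [Matrix.mul_apply] at key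
  simp only [Matrix.mul_apply, Matrix.of_apply, Fintype.sum_prod_type, ite_mul, zero_mul]
  rw [Finset.sum_eq_single i (fun l _ hl => by simp [hl.symm]) (by simp)]
  by_cases hij : i = j
  · subst hij
    simpa [Matrix.one_apply] using key
  · simp [hij]

/-- Compressing a scaled block diagonal matrix by a row of identity blocks sums its blocks. -/
lemma identity_row_mul_blockwise {ι n : Type*} [Fintype ι] [DecidableEq ι] [Fintype n]
    [DecidableEq n] (c : ι → ℝ) (g : ι → Matrix n n ℝ) :
    (Matrix.of fun (a : n) (p : ι × n) => if a = p.2 then (1 : ℝ) else 0) *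
      (Matrix.diagonal fun p : ι × n => c p.1) *
      (Matrix.of fun (p q : ι × n) => if p.1 = q.1 then g p.1 p.2 q.2 else 0) *
      (Matrix.of fun (a : n) (p : ι × n) => if a = p.2 then (1 : ℝ) else 0).transpose =
    ∑ i, c i • g i := by
  ext a b
  simp [Matrix.mul_apply, Matrix.diagonal_apply, Matrix.sum_apply, Fintype.sum_prod_type]

/-- For an invertible `D` with first block row `(I_k, …, I_k)` and
`H = Dᵀ D = diag(h₁, …, h_m)` with each `hᵢ` invertible, the top-left block of
`A = D Λ D⁻¹` is `A₁₁ = Σᵢ λᵢ hᵢ⁻¹`.  Here `m = m' + 1 ≥ 2` and the index set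
`km = k + k·m'` is realized as `Fin k ⊕ (Fin m' × Fin k)`. -/
theorem stmt_3 (m' k : ℕ) (hm : 1 ≤ m') (hk : 1 ≤ k)
    (lam : Fin (m' + 1) → ℝ)
    (Λ D : Matrix (Fin k ⊕ Fin m' × Fin k) (Fin k ⊕ Fin m' × Fin k) ℝ)
    (hΛ : Λ = Matrix.fromBlocks (lam 0 • (1 : Matrix (Fin k) (Fin k) ℝ)) 0 0
        (Matrix.diagonal fun p : Fin m' × Fin k => lam p.1.succ))
    (hDdet : IsUnit D.det)
    (hD11 : D.toBlocks₁₁ = 1)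
    (hD12 : D.toBlocks₁₂ = Matrix.of fun (a : Fin k) (p : Fin m' × Fin k) =>
        if a = p.2 then (1 : ℝ) else 0)
    (h : Fin (m' + 1) → Matrix (Fin k) (Fin k) ℝ)
    (hH : D.transpose * D = Matrix.fromBlocks (h 0) 0 0
        (Matrix.of fun (p q : Fin m' × Fin k) =>
          if p.1 = q.1 then h p.1.succ p.2 q.2 else 0))
    (hinv : ∀ i, IsUnit (h i).det)
    (A : Matrix (Fin k ⊕ Fin m' × Fin k) (Fin k ⊕ Fin m' × Fin k) ℝ)
    (hA : A = D * Λ * D⁻¹) :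
    A.toBlocks₁₁ = ∑ i : Fin (m' + 1), lam i • (h i)⁻¹ := by
  subst hA hΛ
  set E := Matrix.of fun (a : Fin k) (p : Fin m' × Fin k) => if a = p.2 then (1 : ℝ) else 0
    with hE
  set G := Matrix.of fun (p q : Fin m' × Fin k) =>
    if p.1 = q.1 then (h p.1.succ)⁻¹ p.2 q.2 else 0 with hG
  have hDinv : D⁻¹ = Matrix.fromBlocks (h 0)⁻¹ 0 0 G * D.transpose := by
    apply Matrix.inv_eq_left_inv
    rw [Matrix.mul_assoc, hH, Matrix.fromBlocks_multiply, hG,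
      blockwise_mul_eq_one fun i : Fin m' => Matrix.nonsing_inv_mul _ (hinv i.succ),
      Matrix.nonsing_inv_mul _ (hinv 0)]
    simp
  have hsum := identity_row_mul_blockwise (fun i : Fin m' => lam i.succ)
    fun i => (h i.succ)⁻¹
  rw [hDinv, ← Matrix.fromBlocks_toBlocks D, hD11, hD12, Matrix.fromBlocks_transpose,
    Fin.sum_univ_succ, ← hsum]
  simp [Matrix.fromBlocks_multiply, Matrix.mul_assoc, hE, hG]
end

section
/- Let m ≥ 2, k ≥ 1, let λ₁, …, λ_m be reals, Λ = diag(λ₁ I_k, …, λ_m I_k), and let D ∈ ℝ^{km×km} be invertible with D₁₁ = I_k and D₁₂ = (I_k I_k ⋯ I_k), such that H = Dᵀ D is block diagonal, H = diag(h₁, …, h_m) with each h_i invertible. Let A = D Λ D⁻¹ with blocks A₁₁, A₁₂, A₂₁, A₂₂ with respect to the partition (k, k(m−1)), and set P = Σ_{i=1}^{m} λ_i² h_i⁻¹. Then A₁₁² + D₂₁ᵀ (A₂₁ A₁₁ − A₂₂ A₂₁) = P − (λ₁ I_k − A₁₁)². -/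
namespace Matrix

variable {ι κ R : Type*} [DecidableEq ι]

/-- The block diagonal matrix with blocks `M i`, indexed with the block index first. -/
def blockDiag₁ [Zero R] (M : ι → Matrix κ κ R) : Matrix (ι × κ) (ι × κ) R :=
  of fun p q => if p.1 = q.1 then M p.1 p.2 q.2 else 0

theorem blockDiag₁_mul [Fintype ι] [Fintype κ] [NonUnitalNonAssocSemiring R]
    (M N : ι → Matrix κ κ R) :
    blockDiag₁ M * blockDiag₁ N = blockDiag₁ fun i => M i * N i := by
  ext ⟨i, a⟩ ⟨j, b⟩
  simp only [blockDiag₁, mul_apply, of_apply, Fintype.sum_prod_type, ite_mul, zero_mul]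
  rw [Finset.sum_eq_single i]
  · by_cases hij : i = j <;> simp [hij]
  · intro l _ hl
    simp [hl.symm]
  · simp

theorem blockDiag₁_one [DecidableEq κ] [Zero R] [One R] :
    blockDiag₁ (fun _ : ι => (1 : Matrix κ κ R)) = 1 := by
  ext ⟨i, a⟩ ⟨j, b⟩
  by_cases hij : i = j <;> simp [blockDiag₁, one_apply, hij]

theorem diagonal_eq_blockDiag₁ [DecidableEq κ] [Semiring R] (l : ι → R) :
    (diagonal fun p : ι × κ => l p.1) = blockDiag₁ fun i => l i • (1 : Matrix κ κ R) := by
  ext ⟨i, a⟩ ⟨j, b⟩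
  by_cases hij : i = j <;> simp [blockDiag₁, one_apply, diagonal_apply, hij]

/-- Compressing a block diagonal matrix by the row of identities `(I ⋯ I)` sums its blocks. -/
theorem row_one_mul_blockDiag₁_mul_transpose [Fintype ι] [Fintype κ] [DecidableEq κ]
    [NonAssocSemiring R] (M : ι → Matrix κ κ R) (E : Matrix κ (ι × κ) R)
    (hE : E = of fun a p => if a = p.2 then 1 else 0) :
    E * blockDiag₁ M * Eᵀ = ∑ i, M i := by
  subst hE
  ext a b
  simp [blockDiag₁, mul_apply, Fintype.sum_prod_type, sum_apply]

/-- For a symmetric block matrix `A` with `A (I; X) = c (I; X)`, an expression for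
`A₁₁² + Xᵀ (A₂₁ A₁₁ − A₂₂ A₂₁)` in terms of `(A²)₁₁` and `A₁₁`. -/
theorem IsSymm.toBlocks_identity {m n R : Type*} [Fintype m] [Fintype n] [DecidableEq m]
    [CommRing R] {A : Matrix (m ⊕ n) (m ⊕ n) R} (hA : A.IsSymm) {c : R} {X : Matrix n m R}
    (h₁ : A.toBlocks₁₁ + A.toBlocks₁₂ * X = c • 1)
    (h₂ : A.toBlocks₂₁ + A.toBlocks₂₂ * X = c • X) :
    A.toBlocks₁₁ * A.toBlocks₁₁ +
        Xᵀ * (A.toBlocks₂₁ * A.toBlocks₁₁ - A.toBlocks₂₂ * A.toBlocks₂₁) =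
      (A * A).toBlocks₁₁ - (c • 1 - A.toBlocks₁₁) * (c • 1 - A.toBlocks₁₁) := by
  have hsq : (A * A).toBlocks₁₁ =
      A.toBlocks₁₁ * A.toBlocks₁₁ + A.toBlocks₁₂ * A.toBlocks₂₁ := by
    conv_lhs => rw [← fromBlocks_toBlocks A, fromBlocks_multiply, toBlocks_fromBlocks₁₁]
  have s₁₁ : A.toBlocks₁₁ᵀ = A.toBlocks₁₁ := by
    ext i j; exact hA.apply _ _
  have s₁₂ : A.toBlocks₁₂ᵀ = A.toBlocks₂₁ := by
    ext i j; exact hA.apply _ _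
  have s₂₁ : A.toBlocks₂₁ᵀ = A.toBlocks₁₂ := by
    ext i j; exact hA.apply _ _
  have s₂₂ : A.toBlocks₂₂ᵀ = A.toBlocks₂₂ := by
    ext i j; exact hA.apply _ _
  have t₁ : Xᵀ * A.toBlocks₂₁ = c • 1 - A.toBlocks₁₁ := by
    have := congrArg Matrix.transpose h₁
    simp only [transpose_add, transpose_mul, transpose_smul, transpose_one, s₁₁, s₁₂] at this
    exact eq_sub_of_add_eq' this
  have t₂ : Xᵀ * A.toBlocks₂₂ = c • Xᵀ - A.toBlocks₁₂ := by
    have := congrArg Matrix.transpose h₂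
    simp only [transpose_add, transpose_mul, transpose_smul, s₂₁, s₂₂] at this
    exact eq_sub_of_add_eq' this
  rw [hsq, Matrix.mul_sub, ← Matrix.mul_assoc, ← Matrix.mul_assoc, t₂, Matrix.sub_mul,
    Matrix.smul_mul, t₁]
  simp only [Matrix.sub_mul, Matrix.mul_sub, Matrix.smul_mul, Matrix.mul_smul, Matrix.one_mul,
    Matrix.mul_one, smul_sub]
  abel

end Matrix


/-- With `A = D Λ D⁻¹` and `P = Σᵢ λᵢ² hᵢ⁻¹`, one has
`A₁₁² + D₂₁ᵀ (A₂₁ A₁₁ − A₂₂ A₂₁) = P − (λ₁ I_k − A₁₁)²`.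
Here `m = m' + 1 ≥ 2` and the index set `km = k + k·m'` is realized as
`Fin k ⊕ (Fin m' × Fin k)`. -/
theorem stmt_4 (m' k : ℕ) (hm : 1 ≤ m') (hk : 1 ≤ k)
    (lam : Fin (m' + 1) → ℝ)
    (Λ D : Matrix (Fin k ⊕ Fin m' × Fin k) (Fin k ⊕ Fin m' × Fin k) ℝ)
    (hΛ : Λ = Matrix.fromBlocks (lam 0 • (1 : Matrix (Fin k) (Fin k) ℝ)) 0 0
        (Matrix.diagonal fun p : Fin m' × Fin k => lam p.1.succ))
    (hDdet : IsUnit D.det)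
    (hD11 : D.toBlocks₁₁ = 1)
    (hD12 : D.toBlocks₁₂ = Matrix.of fun (a : Fin k) (p : Fin m' × Fin k) =>
        if a = p.2 then (1 : ℝ) else 0)
    (h : Fin (m' + 1) → Matrix (Fin k) (Fin k) ℝ)
    (hH : D.transpose * D = Matrix.fromBlocks (h 0) 0 0
        (Matrix.of fun (p q : Fin m' × Fin k) =>
          if p.1 = q.1 then h p.1.succ p.2 q.2 else 0))
    (hinv : ∀ i, IsUnit (h i).det)
    (A : Matrix (Fin k ⊕ Fin m' × Fin k) (Fin k ⊕ Fin m' × Fin k) ℝ)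
    (hA : A = D * Λ * D⁻¹)
    (P : Matrix (Fin k) (Fin k) ℝ)
    (hP : P = ∑ i : Fin (m' + 1), (lam i) ^ 2 • (h i)⁻¹) :
    A.toBlocks₁₁ * A.toBlocks₁₁ +
      (D.toBlocks₂₁).transpose * (A.toBlocks₂₁ * A.toBlocks₁₁ - A.toBlocks₂₂ * A.toBlocks₂₁)
    = P - (lam 0 • (1 : Matrix (Fin k) (Fin k) ℝ) - A.toBlocks₁₁) *
        (lam 0 • (1 : Matrix (Fin k) (Fin k) ℝ) - A.toBlocks₁₁) := by
  have hΛ' : Λ = Matrix.fromBlocks (lam 0 • 1) 0 0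
      (Matrix.blockDiag₁ fun i => lam i.succ • 1) := by
    rw [hΛ, ← Matrix.diagonal_eq_blockDiag₁ fun i : Fin m' => lam i.succ]
  have hH' : D.transpose * D = Matrix.fromBlocks (h 0) 0 0
      (Matrix.blockDiag₁ fun i => h i.succ) := hH
  have hcomm : Λ * (D.transpose * D) = D.transpose * D * Λ := by
    simp [hΛ', hH', Matrix.fromBlocks_multiply, Matrix.blockDiag₁_mul]
  have hD : D⁻¹ * D = 1 := Matrix.nonsing_inv_mul D hDdet
  have hAD : A * D = D * Λ := by
    rw [hA, Matrix.mul_assoc, hD, Matrix.mul_one]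
  have hAsymm : A.IsSymm := by
    have hDT : D.transpose⁻¹ * D.transpose = 1 :=
      Matrix.nonsing_inv_mul _ (by rwa [Matrix.det_transpose])
    have hΛT : Λ.transpose = Λ := by
      simp [hΛ, Matrix.fromBlocks_transpose]
    calc A.transpose = D.transpose⁻¹ * (Λ * (D.transpose * D)) * D⁻¹ := by
          simp only [hA, Matrix.transpose_mul, hΛT, Matrix.transpose_nonsing_inv,
            Matrix.mul_assoc, Matrix.mul_nonsing_inv D hDdet, Matrix.mul_one]
      _ = D.transpose⁻¹ * D.transpose * (D * Λ * D⁻¹) := by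
          rw [hcomm]
          simp only [Matrix.mul_assoc]
      _ = A := by rw [hDT, Matrix.one_mul, hA]
  have hDinv : D⁻¹ = Matrix.fromBlocks (h 0)⁻¹ 0 0
      (Matrix.blockDiag₁ fun i => (h i.succ)⁻¹) * D.transpose := by
    apply Matrix.inv_eq_left_inv
    rw [Matrix.mul_assoc, hH']
    simp [Matrix.fromBlocks_multiply, Matrix.blockDiag₁_mul, Matrix.nonsing_inv_mul _ (hinv _),
      Matrix.blockDiag₁_one]
  have hDblocks : D = Matrix.fromBlocks 1 D.toBlocks₁₂ D.toBlocks₂₁ D.toBlocks₂₂ := by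
    conv_lhs => rw [← Matrix.fromBlocks_toBlocks D, hD11]
  have hAA : (A * A).toBlocks₁₁ = P := by
    have hsq : A * A = D * (Λ * Λ * Matrix.fromBlocks (h 0)⁻¹ 0 0
        (Matrix.blockDiag₁ fun i => (h i.succ)⁻¹)) * D.transpose := by
      conv_lhs => rw [hA, ← Matrix.mul_assoc, ← Matrix.mul_assoc, ← hA, hAD, hDinv]
      simp only [Matrix.mul_assoc]
    rw [hsq, hDblocks, hΛ']
    simp only [Matrix.fromBlocks_transpose, Matrix.fromBlocks_multiply,
      Matrix.toBlocks_fromBlocks₁₁, Matrix.blockDiag₁_mul, Matrix.mul_zero, Matrix.zero_mul,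
      Matrix.one_mul, Matrix.mul_one, Matrix.transpose_one, add_zero, zero_add,
      Matrix.smul_mul, smul_smul]
    rw [Matrix.row_one_mul_blockDiag₁_mul_transpose _ _ hD12, hP, Fin.sum_univ_succ]
    simp only [sq]
  have hcols : Matrix.fromBlocks A.toBlocks₁₁ A.toBlocks₁₂ A.toBlocks₂₁ A.toBlocks₂₂ *
      Matrix.fromBlocks 1 D.toBlocks₁₂ D.toBlocks₂₁ D.toBlocks₂₂ =
      Matrix.fromBlocks 1 D.toBlocks₁₂ D.toBlocks₂₁ D.toBlocks₂₂ * Λ := by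
    rw [Matrix.fromBlocks_toBlocks, ← hDblocks, hAD]
  rw [hΛ', Matrix.fromBlocks_multiply, Matrix.fromBlocks_multiply, Matrix.fromBlocks_inj] at hcols
  obtain ⟨h₁, -, h₂, -⟩ := hcols
  rw [← hAA]
  exact hAsymm.toBlocks_identity (by simpa using h₁) (by simpa using h₂)
end

section
/- Let m ≥ 2, k ≥ 1, let λ₁, …, λ_m be reals, Λ = diag(λ₁ I_k, …, λ_m I_k), and let D ∈ ℝ^{km×km} be invertible with D₁₁ = I_k and D₁₂ = (I_k I_k ⋯ I_k), such that H = Dᵀ D is block diagonal, H = diag(h₁, …, h_m) with each h_i invertible. Let A = D Λ D⁻¹ with blocks A₁₁, A₁₂, A₂₁, A₂₂ with respect to the partition (k, k(m−1)), set P = Σ_{i=1}^{m} λ_i² h_i⁻¹ and Λ₂ = diag(λ₂ I_k, …, λ_m I_k). Then D₁₂ᵀ A₁₁² + D₂₂ᵀ (A₂₁ A₁₁ − A₂₂ A₂₁) = D₁₂ᵀ P − D₁₂ᵀ A₁₁² − Λ₂² D₁₂ᵀ + 2 Λ₂ D₁₂ᵀ A₁₁. -/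
open Matrix

/-- Block diagonal matrix whose rows and columns are indexed with the block index first. -/
def blockDiagonalFst {m' k : ℕ} (f : Fin m' → Matrix (Fin k) (Fin k) ℝ) :
    Matrix (Fin m' × Fin k) (Fin m' × Fin k) ℝ :=
  Matrix.of fun p q => if p.1 = q.1 then f p.1 p.2 q.2 else 0

theorem blockDiagonalFst_mul {m' k : ℕ} (f g : Fin m' → Matrix (Fin k) (Fin k) ℝ) :
    blockDiagonalFst f * blockDiagonalFst g = blockDiagonalFst fun i => f i * g i := by
  ext ⟨i, a⟩ ⟨j, b⟩
  simp only [blockDiagonalFst, Matrix.mul_apply, Matrix.of_apply, Fintype.sum_prod_type]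
  rw [Finset.sum_eq_single i]
  · by_cases hij : i = j <;> simp [hij]
  · intro l _ hl
    simp [hl.symm]
  · simp

theorem blockDiagonalFst_smul_one {m' k : ℕ} (c : Fin m' → ℝ) :
    (blockDiagonalFst fun i => c i • (1 : Matrix (Fin k) (Fin k) ℝ)) =
      Matrix.diagonal fun p : Fin m' × Fin k => c p.1 := by
  ext ⟨i, a⟩ ⟨j, b⟩
  by_cases hij : i = j <;> by_cases hab : a = b <;>
    simp [blockDiagonalFst, Matrix.one_apply, hij, hab]

theorem blockDiagonalFst_one {m' k : ℕ} :
    (blockDiagonalFst fun _ => 1 : Matrix (Fin m' × Fin k) (Fin m' × Fin k) ℝ) = 1 := by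
  simpa using blockDiagonalFst_smul_one (m' := m') (k := k) fun _ => 1

/-- Compressing a block diagonal matrix by the row `(I ⋯ I)` sums its blocks. -/
theorem row_one_mul_blockDiagonalFst_mul_transpose {m' k : ℕ}
    (E : Matrix (Fin k) (Fin m' × Fin k) ℝ)
    (hE : E = Matrix.of fun (a : Fin k) (p : Fin m' × Fin k) => if a = p.2 then (1 : ℝ) else 0)
    (f : Fin m' → Matrix (Fin k) (Fin k) ℝ) :
    E * blockDiagonalFst f * Eᵀ = ∑ i, f i := by
  subst hE
  ext a b
  simp [blockDiagonalFst, Matrix.mul_apply, Fintype.sum_prod_type, Matrix.sum_apply]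


/-- With `A = D Λ D⁻¹`, `P = Σᵢ λᵢ² hᵢ⁻¹` and
`Λ₂ = diag(λ₂ I_k, …, λ_m I_k)`, one has
`D₁₂ᵀ A₁₁² + D₂₂ᵀ (A₂₁ A₁₁ − A₂₂ A₂₁) = D₁₂ᵀ P − D₁₂ᵀ A₁₁² − Λ₂² D₁₂ᵀ + 2 Λ₂ D₁₂ᵀ A₁₁`.
Here `m = m' + 1 ≥ 2` and the index set `km = k + k·m'` is realized as
`Fin k ⊕ (Fin m' × Fin k)`. -/
theorem stmt_5 (m' k : ℕ) (hm : 1 ≤ m') (hk : 1 ≤ k)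
    (lam : Fin (m' + 1) → ℝ)
    (Λ D : Matrix (Fin k ⊕ Fin m' × Fin k) (Fin k ⊕ Fin m' × Fin k) ℝ)
    (hΛ : Λ = Matrix.fromBlocks (lam 0 • (1 : Matrix (Fin k) (Fin k) ℝ)) 0 0
        (Matrix.diagonal fun p : Fin m' × Fin k => lam p.1.succ))
    (hDdet : IsUnit D.det)
    (hD11 : D.toBlocks₁₁ = 1)
    (hD12 : D.toBlocks₁₂ = Matrix.of fun (a : Fin k) (p : Fin m' × Fin k) =>
        if a = p.2 then (1 : ℝ) else 0)
    (h : Fin (m' + 1) → Matrix (Fin k) (Fin k) ℝ)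
    (hH : D.transpose * D = Matrix.fromBlocks (h 0) 0 0
        (Matrix.of fun (p q : Fin m' × Fin k) =>
          if p.1 = q.1 then h p.1.succ p.2 q.2 else 0))
    (hinv : ∀ i, IsUnit (h i).det)
    (A : Matrix (Fin k ⊕ Fin m' × Fin k) (Fin k ⊕ Fin m' × Fin k) ℝ)
    (hA : A = D * Λ * D⁻¹)
    (P : Matrix (Fin k) (Fin k) ℝ)
    (hP : P = ∑ i : Fin (m' + 1), (lam i) ^ 2 • (h i)⁻¹)
    (Λ₂ : Matrix (Fin m' × Fin k) (Fin m' × Fin k) ℝ)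
    (hΛ₂ : Λ₂ = Matrix.diagonal fun p : Fin m' × Fin k => lam p.1.succ) :
    (D.toBlocks₁₂).transpose * (A.toBlocks₁₁ * A.toBlocks₁₁) +
      (D.toBlocks₂₂).transpose * (A.toBlocks₂₁ * A.toBlocks₁₁ - A.toBlocks₂₂ * A.toBlocks₂₁)
    = (D.toBlocks₁₂).transpose * P - (D.toBlocks₁₂).transpose * (A.toBlocks₁₁ * A.toBlocks₁₁)
      - Λ₂ * Λ₂ * (D.toBlocks₁₂).transpose
      + (2 : ℝ) • (Λ₂ * (D.toBlocks₁₂).transpose * A.toBlocks₁₁) := by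
  set E := D.toBlocks₁₂
  set D₂₁ := D.toBlocks₂₁
  set D₂₂ := D.toBlocks₂₂
  have hD : D = Matrix.fromBlocks 1 E D₂₁ D₂₂ := by
    rw [← hD11]; exact (Matrix.fromBlocks_toBlocks D).symm
  have hAb : A = Matrix.fromBlocks A.toBlocks₁₁ A.toBlocks₁₂ A.toBlocks₂₁ A.toBlocks₂₂ :=
    (Matrix.fromBlocks_toBlocks A).symm
  have hΛ₂b : Λ₂ = blockDiagonalFst fun i => lam i.succ • 1 := by
    rw [hΛ₂, blockDiagonalFst_smul_one fun i => lam i.succ]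
  rw [← hΛ₂] at hΛ
  change Dᵀ * D = Matrix.fromBlocks (h 0) 0 0 (blockDiagonalFst fun i => h i.succ) at hH
  have hcomm : Dᵀ * D * Λ = Λ * (Dᵀ * D) := by
    rw [hH, hΛ, hΛ₂b]
    simp [Matrix.fromBlocks_multiply, blockDiagonalFst_mul]
  have hDA : Dᵀ * A = Λ * Dᵀ := by
    rw [hA, ← Matrix.mul_assoc, ← Matrix.mul_assoc, hcomm, Matrix.mul_assoc, Matrix.mul_assoc,
      Matrix.mul_nonsing_inv _ hDdet, Matrix.mul_one]
  have hDinv : D⁻¹ =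
      Matrix.fromBlocks (h 0)⁻¹ 0 0 (blockDiagonalFst fun i => (h i.succ)⁻¹) * Dᵀ := by
    apply Matrix.inv_eq_left_inv
    rw [Matrix.mul_assoc, hH]
    simp [Matrix.fromBlocks_multiply, blockDiagonalFst_mul, Matrix.nonsing_inv_mul _ (hinv _),
      blockDiagonalFst_one]
  have hAA : A * A = D * (Λ * Λ * Matrix.fromBlocks (h 0)⁻¹ 0 0
      (blockDiagonalFst fun i => (h i.succ)⁻¹)) * Dᵀ := by
    have : A * A = D * Λ * (D⁻¹ * D) * Λ * D⁻¹ := by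
      rw [hA]; simp only [Matrix.mul_assoc]
    rw [this, Matrix.nonsing_inv_mul _ hDdet, hDinv]
    simp only [Matrix.mul_assoc, Matrix.one_mul]
  have hP' : A.toBlocks₁₁ * A.toBlocks₁₁ + A.toBlocks₁₂ * A.toBlocks₂₁ = P := by
    have hl : (A * A).toBlocks₁₁ =
        A.toBlocks₁₁ * A.toBlocks₁₁ + A.toBlocks₁₂ * A.toBlocks₂₁ := by
      conv_lhs => rw [hAb, Matrix.fromBlocks_multiply, Matrix.toBlocks_fromBlocks₁₁]
    rw [← hl, hAA, hD, hΛ, hΛ₂b]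
    simp only [Matrix.fromBlocks_transpose, Matrix.fromBlocks_multiply, blockDiagonalFst_mul,
      Matrix.toBlocks_fromBlocks₁₁, Matrix.mul_zero, Matrix.zero_mul, add_zero, zero_add,
      Matrix.transpose_one, Matrix.mul_one, Matrix.one_mul,
      row_one_mul_blockDiagonalFst_mul_transpose E hD12]
    rw [hP, Fin.sum_univ_succ]
    simp [smul_smul, pow_two]
  rw [hAb, hD, hΛ, Matrix.fromBlocks_transpose, Matrix.fromBlocks_multiply,
    Matrix.fromBlocks_multiply, Matrix.fromBlocks_inj] at hDA
  obtain ⟨-, -, h₁, h₂⟩ := hDA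
  simp only [Matrix.zero_mul, zero_add] at h₁ h₂
  have h₁' : D₂₂ᵀ * A.toBlocks₂₁ = Λ₂ * Eᵀ - Eᵀ * A.toBlocks₁₁ := eq_sub_of_add_eq' h₁
  have h₂' : D₂₂ᵀ * A.toBlocks₂₂ = Λ₂ * D₂₂ᵀ - Eᵀ * A.toBlocks₁₂ := eq_sub_of_add_eq' h₂
  rw [Matrix.mul_sub, ← Matrix.mul_assoc D₂₂ᵀ, ← Matrix.mul_assoc D₂₂ᵀ, h₁', h₂', Matrix.sub_mul,
    Matrix.sub_mul, Matrix.mul_assoc Λ₂ D₂₂ᵀ, h₁', ← hP', two_smul]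
  simp only [Matrix.mul_sub, Matrix.mul_add, Matrix.mul_assoc]
  abel
end

section
/- Let F : ℝ → ℝ and γ : ℝ → ℝ be differentiable with γ′(u) = |F′(u)| for all u, let β ∈ (0, 1) and λ > 0, and define M₁(u) = ½((γ(u) − F(u))/λ + βu), M₃(u) = ½((γ(u) + F(u))/λ + βu), and M₂(u) = (1 − β)u − γ(u)/λ. If at a point u one has λ > |F′(u)|/(1 − β), then M₁′(u) > 0, M₂′(u) > 0, and M₃′(u) > 0. -/
/-- The three Maxwellians of the 3×3 BGK model are strictly increasing
at any point `u` where `λ > |F′(u)|/(1 − β)`. -/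
theorem stmt_7 (F γ : ℝ → ℝ) (hF : Differentiable ℝ F) (hγ : Differentiable ℝ γ)
    (hγ' : ∀ u, deriv γ u = |deriv F u|)
    (β l : ℝ) (hβ : β ∈ Set.Ioo (0 : ℝ) 1) (hl : 0 < l)
    (M₁ M₂ M₃ : ℝ → ℝ)
    (hM₁ : M₁ = fun u => (1 / 2) * ((γ u - F u) / l + β * u))
    (hM₃ : M₃ = fun u => (1 / 2) * ((γ u + F u) / l + β * u))
    (hM₂ : M₂ = fun u => (1 - β) * u - γ u / l)
    (u : ℝ) (hu : |deriv F u| / (1 - β) < l) :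
    0 < deriv M₁ u ∧ 0 < deriv M₂ u ∧ 0 < deriv M₃ u := by
  obtain ⟨hβ0, hβ1⟩ := hβ
  have hFu := (hF u).hasDerivAt
  have hγu := (hγ u).hasDerivAt
  rw [hγ' u] at hγu
  have h₁ : HasDerivAt M₁ ((1 / 2) * ((|deriv F u| - deriv F u) / l + β * 1)) u := by
    rw [hM₁]
    exact (((hγu.sub hFu).div_const l).add ((hasDerivAt_id' u).const_mul β)).const_mul (1 / 2)
  have h₂ : HasDerivAt M₂ ((1 - β) * 1 - |deriv F u| / l) u := by
    rw [hM₂]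
    exact ((hasDerivAt_id' u).const_mul (1 - β)).sub (hγu.div_const l)
  have h₃ : HasDerivAt M₃ ((1 / 2) * ((|deriv F u| + deriv F u) / l + β * 1)) u := by
    rw [hM₃]
    exact (((hγu.add hFu).div_const l).add ((hasDerivAt_id' u).const_mul β)).const_mul (1 / 2)
  rw [h₁.deriv, h₂.deriv, h₃.deriv]
  refine ⟨?_, ?_, ?_⟩
  · have := div_nonneg (sub_nonneg.mpr (le_abs_self (deriv F u))) hl.le
    linarith
  · have : |deriv F u| / l < 1 - β := by
      rw [div_lt_iff₀ (sub_pos.mpr hβ1)] at hu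
      rw [div_lt_iff₀ hl]
      linarith
    linarith
  · have : 0 ≤ (|deriv F u| + deriv F u) / l :=
      div_nonneg (by linarith [neg_abs_le (deriv F u)]) hl.le
    linarith
end

section
/- Let a > 0, β ∈ (0, 1), λ > 0, set α = a + βλ, and assume α < λ. Let D ∈ ℝ^{3×3} be the matrix with rows (1, 1, 1), (((α+a)/(α−a))·√(λ(α−a)/(α(α+a))), 0, −√(λ(α−a)/(α(α+a)))), and (−√((λ−α)/α), −√((λ−α)/α) + λ/√(α(λ−α)), −√((λ−α)/α)), and let Λ = diag(−λ, 0, λ). Then D is invertible, Dᵀ D = diag(2λ/(α−a), λ/(λ−α), 2λ/(α+a)), the matrix A = D Λ D⁻¹ is symmetric, and the (1,1) entry of A equals a. -/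
/-- The conservative–dissipative change of variables for the 3×3 BGK
model: with `α = a + βλ`, `a < α < λ`, the explicit matrix `D` is invertible,
`Dᵀ D = diag(2λ/(α−a), λ/(λ−α), 2λ/(α+a))`, `A = D Λ D⁻¹` is symmetric and its
(1,1) entry equals `a`. -/
theorem stmt_8 (a β l : ℝ) (ha : 0 < a) (hβ : β ∈ Set.Ioo (0 : ℝ) 1) (hl : 0 < l)
    (α : ℝ) (hα : α = a + β * l) (hαl : α < l)
    (D Λ : Matrix (Fin 3) (Fin 3) ℝ)
    (hD : D = !![1, 1, 1;
      ((α + a) / (α - a)) * Real.sqrt (l * (α - a) / (α * (α + a))), 0,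
        -Real.sqrt (l * (α - a) / (α * (α + a)));
      -Real.sqrt ((l - α) / α), -Real.sqrt ((l - α) / α) + l / Real.sqrt (α * (l - α)),
        -Real.sqrt ((l - α) / α)])
    (hΛ : Λ = !![-l, 0, 0; 0, 0, 0; 0, 0, l]) :
    IsUnit D.det ∧
    D.transpose * D = !![2 * l / (α - a), 0, 0; 0, l / (l - α), 0; 0, 0, 2 * l / (α + a)] ∧
    (D * Λ * D⁻¹).IsSymm ∧
    (D * Λ * D⁻¹) 0 0 = a := by
  have hα0 : 0 < α := by rw [hα]; have := mul_pos hβ.1 hl; linarith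
  have hm : 0 < α - a := by rw [hα]; have := mul_pos hβ.1 hl; linarith
  have hp : 0 < α + a := by linarith
  have hd : 0 < l - α := by linarith
  have hsqrt : Real.sqrt (α * (l - α)) = α * Real.sqrt ((l - α) / α) := by
    rw [show α * (l - α) = α ^ 2 * ((l - α) / α) by field_simp,
      Real.sqrt_mul (sq_nonneg α), Real.sqrt_sq hα0.le]
  have hs : Real.sqrt (l * (α - a) / (α * (α + a))) ^ 2 = l * (α - a) / (α * (α + a)) :=
    Real.sq_sqrt (by positivity)
  have ht : Real.sqrt ((l - α) / α) ^ 2 = (l - α) / α := Real.sq_sqrt (by positivity)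
  have ht0 : 0 < Real.sqrt ((l - α) / α) := Real.sqrt_pos.2 (by positivity)
  rw [hsqrt] at hD
  generalize Real.sqrt (l * (α - a) / (α * (α + a))) = s at hs hD
  generalize Real.sqrt ((l - α) / α) = t at ht ht0 hD
  have hlt : l = α * (1 + t ^ 2) := by rw [ht]; field_simp; ring
  have hmid : -t + l / (α * t) = t⁻¹ := by rw [hlt]; field_simp; ring
  rw [hmid] at hD
  have hG : D.transpose * D =
      !![2 * l / (α - a), 0, 0; 0, l / (l - α), 0; 0, 0, 2 * l / (α + a)] := by
    have h00 : 1 + (α + a) / (α - a) * s * ((α + a) / (α - a) * s) + t * t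
        = 2 * l / (α - a) := by
      rw [show 1 + (α + a) / (α - a) * s * ((α + a) / (α - a) * s) + t * t
        = 1 + ((α + a) / (α - a)) ^ 2 * s ^ 2 + t ^ 2 by ring, hs, ht]
      field_simp; ring
    have h02 : 1 - (α + a) / (α - a) * s * s + t * t = 0 := by
      rw [show 1 - (α + a) / (α - a) * s * s + t * t
        = 1 - (α + a) / (α - a) * s ^ 2 + t ^ 2 by ring, hs, ht]
      field_simp; ring
    have h11 : 1 + t⁻¹ * t⁻¹ = l / (l - α) := by
      rw [← mul_inv, ← sq, ht]
      field_simp; ring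
    have h22 : 1 + s * s + t * t = 2 * l / (α + a) := by
      rw [← sq, ← sq, hs, ht]
      field_simp; ring
    have htt : t * t⁻¹ = 1 := mul_inv_cancel₀ ht0.ne'
    rw [hD]
    ext i j
    fin_cases i <;> fin_cases j <;>
      simp [Matrix.mul_apply, Fin.sum_univ_three] <;> linarith
  set M : Matrix (Fin 3) (Fin 3) ℝ :=
    Matrix.diagonal ![(α - a) / (2 * l), (l - α) / l, (α + a) / (2 * l)] with hM
  have hleft : M * D.transpose * D = 1 := by
    rw [Matrix.mul_assoc, hG, hM]
    ext i j
    fin_cases i <;> fin_cases j <;> simp [Matrix.diagonal_mul] <;> field_simp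
  have hinv : D⁻¹ = M * D.transpose := Matrix.inv_eq_left_inv hleft
  have hΛ' : Λ * M = Matrix.diagonal ![-(α - a) / 2, 0, (α + a) / 2] := by
    rw [hΛ, hM]
    ext i j
    fin_cases i <;> fin_cases j <;> simp [Matrix.mul_diagonal] <;> field_simp <;> ring
  have hA : D * Λ * D⁻¹ =
      D * Matrix.diagonal ![-(α - a) / 2, 0, (α + a) / 2] * D.transpose := by
    rw [hinv, ← hΛ']
    simp only [Matrix.mul_assoc]
  refine ⟨(Matrix.isUnit_iff_isUnit_det D).1 (IsUnit.of_mul_eq_one_right _ hleft), hG, ?_, ?_⟩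
  · rw [hA, Matrix.IsSymm]
    simp [Matrix.transpose_mul, Matrix.mul_assoc]
  · rw [hA, hD]
    simp [Matrix.mul_apply, Fin.sum_univ_three, Matrix.vecMul_diagonal]
    ring
end

section
/- Let F : ℝ → ℝ be continuously differentiable with a = F′(0) > 0, let λ > a, set a₊ = λ + a, a₋ = λ − a and q = λ. Define M₁(u) = (λu − F(u))/(2λ) and M₂(u) = (λu + F(u))/(2λ), and suppose there exist m₁ > 0 and m₂ > 0 with M₁′(u) ≥ m₁ and M₂′(u) ≥ m₂ for all u. Let ρ > 0 and define Γ₁(u) = ((q − a²ρ)/(2a₊)) M₁(u) − (a₋²/(4λ)) ρ u and Γ₂(u) = −((q − a²ρ)/(2a₋)) M₂(u) + (a₊²/(4λ)) ρ u. If ρ ≤ min( 2λ² m₁/(2a²λ m₁ + a₊ a₋²), 2λ² m₂/(2a²λ m₂ + a₊² a₋) ), then Γ₁′(u) ≥ 0 and Γ₂′(u) ≤ 0 for all u. -/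
/-- The CFL restriction on `ρ` bounds the coefficient of `ρ` by the Maxwellian contribution. -/
theorem cfl_coefficient_le {a l k s m d ρ : ℝ} (hl : 0 < l) (hk : 0 < k) (hs : 0 ≤ s)
    (ha : 0 < a) (hm : 0 < m) (hd : m ≤ d) (hρ : 0 ≤ ρ)
    (h : ρ ≤ 2 * l ^ 2 * m / (2 * a ^ 2 * l * m + k * s)) :
    s / (4 * l) * ρ ≤ (l - a ^ 2 * ρ) / (2 * k) * d := by
  rw [le_div_iff₀ (by positivity)] at h
  have hmul : s * ρ * k ≤ 2 * l * m * (l - a ^ 2 * ρ) := by linarith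
  have hnonneg : 0 ≤ l - a ^ 2 * ρ := by
    have hprod : 0 ≤ 2 * l * m * (l - a ^ 2 * ρ) := le_trans (by positivity) hmul
    exact nonneg_of_mul_nonneg_right hprod (by positivity)
  calc s / (4 * l) * ρ ≤ (l - a ^ 2 * ρ) / (2 * k) * m := by
        rw [div_mul_eq_mul_div, div_mul_eq_mul_div, div_le_div_iff₀ (by positivity) (by positivity)]
        linarith
    _ ≤ (l - a ^ 2 * ρ) / (2 * k) * d := by gcongr

/-- Under the CFL-type restriction on `ρ`, the TAHO source-upwinding
coefficient functions satisfy `Γ₁′(u) ≥ 0` and `Γ₂′(u) ≤ 0` for all `u`. -/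
theorem stmt_11 (F : ℝ → ℝ) (hF : ContDiff ℝ 1 F)
    (a : ℝ) (ha : a = deriv F 0) (ha0 : 0 < a)
    (l : ℝ) (hl : a < l)
    (ap am q : ℝ) (hap : ap = l + a) (ham : am = l - a) (hq : q = l)
    (M₁ M₂ : ℝ → ℝ)
    (hM₁ : M₁ = fun u => (l * u - F u) / (2 * l))
    (hM₂ : M₂ = fun u => (l * u + F u) / (2 * l))
    (m₁ m₂ : ℝ) (hm₁ : 0 < m₁) (hm₂ : 0 < m₂)
    (hm₁' : ∀ u, m₁ ≤ deriv M₁ u) (hm₂' : ∀ u, m₂ ≤ deriv M₂ u)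
    (ρ : ℝ) (hρ : 0 < ρ)
    (Γ₁ Γ₂ : ℝ → ℝ)
    (hΓ₁ : Γ₁ = fun u => ((q - a ^ 2 * ρ) / (2 * ap)) * M₁ u - (am ^ 2 / (4 * l)) * ρ * u)
    (hΓ₂ : Γ₂ = fun u => -((q - a ^ 2 * ρ) / (2 * am)) * M₂ u + (ap ^ 2 / (4 * l)) * ρ * u)
    (hρle : ρ ≤ min (2 * l ^ 2 * m₁ / (2 * a ^ 2 * l * m₁ + ap * am ^ 2))
        (2 * l ^ 2 * m₂ / (2 * a ^ 2 * l * m₂ + ap ^ 2 * am))) :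
    ∀ u, 0 ≤ deriv Γ₁ u ∧ deriv Γ₂ u ≤ 0 := by
  have hl0 : 0 < l := ha0.trans hl
  have hap0 : 0 < ap := by linarith
  have ham0 : 0 < am := by linarith
  have hFd : Differentiable ℝ F := hF.differentiable (by norm_num)
  have hM₁d : Differentiable ℝ M₁ := by
    rw [hM₁]
    fun_prop
  have hM₂d : Differentiable ℝ M₂ := by
    rw [hM₂]
    fun_prop
  obtain ⟨h₁, h₂⟩ := le_min_iff.mp hρle
  rw [mul_comm (ap ^ 2) am] at h₂
  intro u
  have hΓ₁' : HasDerivAt Γ₁ ((q - a ^ 2 * ρ) / (2 * ap) * deriv M₁ u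
      - am ^ 2 / (4 * l) * ρ * 1) u := by
    rw [hΓ₁]
    exact ((hM₁d u).hasDerivAt.const_mul _).sub ((hasDerivAt_id u).const_mul _)
  have hΓ₂' : HasDerivAt Γ₂ (-((q - a ^ 2 * ρ) / (2 * am)) * deriv M₂ u
      + ap ^ 2 / (4 * l) * ρ * 1) u := by
    rw [hΓ₂]
    exact ((hM₂d u).hasDerivAt.const_mul _).add ((hasDerivAt_id u).const_mul _)
  rw [hΓ₁'.deriv, hΓ₂'.deriv, hq]
  have hb₁ := cfl_coefficient_le hl0 hap0 (sq_nonneg am) ha0 hm₁ (hm₁' u) hρ.le h₁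
  have hb₂ := cfl_coefficient_le hl0 ham0 (sq_nonneg ap) ha0 hm₂ (hm₂' u) hρ.le h₂
  constructor <;> linarith
end

section
/- Let F : ℝ → ℝ be continuously differentiable with a = F′(0) > 0, let λ satisfy λ > 2a and λ ≥ |F′(u)| for all u, and set a₊ = λ + a, a₋ = λ − a. Define M₁(u) = (λu − F(u))/(2λ) and M₂(u) = (λu + F(u))/(2λ). Let ρ > 0 and 0 < Δx ≤ a²/(λ + a). Then for all u: (1 − λ/(2a₋) + (ρ/2)(a²/a₋ − Δx)) M₂′(u) + (a₊²/(4λ)) ρ ≥ 0 and (1 − λ/(2a₊) + (ρ/2)(a²/a₊ − Δx)) M₁′(u) + (a₋²/(4λ)) ρ ≥ 0. -/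
/-- The two monotonicity inequalities of Proposition 4.1 of the paper:
for `λ > 2a`, `λ ≥ |F′(u)|` for all `u`, `ρ > 0` and `0 < Δx ≤ a²/(λ+a)`, one has
`(1 − λ/(2a₋) + (ρ/2)(a²/a₋ − Δx)) M₂′(u) + (a₊²/(4λ)) ρ ≥ 0` and
`(1 − λ/(2a₊) + (ρ/2)(a²/a₊ − Δx)) M₁′(u) + (a₋²/(4λ)) ρ ≥ 0`. -/
theorem stmt_12 (F : ℝ → ℝ) (hF : ContDiff ℝ 1 F)
    (a : ℝ) (ha : a = deriv F 0) (ha0 : 0 < a)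
    (l : ℝ) (hl : 2 * a < l) (hl' : ∀ u, |deriv F u| ≤ l)
    (ap am : ℝ) (hap : ap = l + a) (ham : am = l - a)
    (M₁ M₂ : ℝ → ℝ)
    (hM₁ : M₁ = fun u => (l * u - F u) / (2 * l))
    (hM₂ : M₂ = fun u => (l * u + F u) / (2 * l))
    (ρ Δx : ℝ) (hρ : 0 < ρ) (hΔx : 0 < Δx) (hΔx' : Δx ≤ a ^ 2 / (l + a)) :
    ∀ u,
      0 ≤ (1 - l / (2 * am) + (ρ / 2) * (a ^ 2 / am - Δx)) * deriv M₂ u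
            + (ap ^ 2 / (4 * l)) * ρ ∧
      0 ≤ (1 - l / (2 * ap) + (ρ / 2) * (a ^ 2 / ap - Δx)) * deriv M₁ u
            + (am ^ 2 / (4 * l)) * ρ := by
  intro u
  subst hap ham
  have hl0 : 0 < l := by linarith
  have hdF : HasDerivAt F (deriv F u) u :=
    (hF.differentiable (by norm_num) u).hasDerivAt
  obtain ⟨hlow, hupp⟩ := abs_le.mp (hl' u)
  have hlin : HasDerivAt (fun u => l * u) l u := by
    simpa using (hasDerivAt_id u).const_mul l
  have hd₁ : deriv M₁ u = (l - deriv F u) / (2 * l) := by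
    rw [hM₁]; exact ((hlin.sub hdF).div_const _).deriv
  have hd₂ : deriv M₂ u = (l + deriv F u) / (2 * l) := by
    rw [hM₂]; exact ((hlin.add hdF).div_const _).deriv
  have hM₁' : 0 ≤ deriv M₁ u := by
    rw [hd₁]; exact div_nonneg (by linarith) (by linarith)
  have hM₂' : 0 ≤ deriv M₂ u := by
    rw [hd₂]; exact div_nonneg (by linarith) (by linarith)
  have hm : l / (2 * (l - a)) ≤ 1 := by
    rw [div_le_one (by linarith)]; linarith
  have hp : l / (2 * (l + a)) ≤ 1 := by
    rw [div_le_one (by linarith)]; linarith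
  have hmono : a ^ 2 / (l + a) ≤ a ^ 2 / (l - a) :=
    div_le_div_of_nonneg_left (sq_nonneg a) (by linarith) (by linarith)
  constructor
  · have h : 0 ≤ (ρ / 2) * (a ^ 2 / (l - a) - Δx) :=
      mul_nonneg (by linarith) (by linarith)
    exact add_nonneg (mul_nonneg (by linarith) hM₂') (by positivity)
  · have h : 0 ≤ (ρ / 2) * (a ^ 2 / (l + a) - Δx) :=
      mul_nonneg (by linarith) (by linarith)
    exact add_nonneg (mul_nonneg (by linarith) hM₁') (by positivity)
end

section
/- Let F : ℝ → ℝ and γ : ℝ → ℝ be differentiable with γ′ = |F′|, let β ∈ (0, 1), λ > 0, a ∈ ℝ with a ≠ 0, λ ≠ a, λ ≠ −a, and set α = a + βλ. Define M₁(u) = ½((γ(u) − F(u))/λ + βu), M₃(u) = ½((γ(u) + F(u))/λ + βu), M₂(u) = (1 − β)u − γ(u)/λ, and let ρ ∈ ℝ. Define g₁ = λ(1 − ρα)/(2(λ + a)) + ρ(λ + a)/2, g₂ = −ρ(λα − a²)/(2a), g₃ = −λ(1 − ρα)/(2(λ − a)) − ρ(λ − a)/2, and Γ₁(u) = (λ(1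 − ρα)/(2(λ + a))) M₁(u) + (ρ(α − a)/(4λ))(a u − F(u)), Γ₂(u) = −(ρλα/(2a)) M₂(u) + (ρ(λ − α)/(2λ))(a u − F(u)), Γ₃(u) = −(λ(1 − ρα)/(2(λ − a))) M₃(u) + (ρ(α + a)/(4λ))(a u − F(u)). Then for all u and for i = 1, 2, 3: Γ_i′(u) = g_i M_i′(u) + (ρ/2)( h_i⁻¹ (a − F′(u)) + (λ_i − a) M_i′(u) ), where (λ₁, λ₂, λ₃) = (−λ, 0, λ) and h₁⁻¹ = (α − a)/(2λ), h₂⁻¹ = (λ − α)/λ, h₃⁻¹ = (α + a)/(2λ). -/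
theorem deriv_const_mul_add_const_mul_linear_sub {F M : ℝ → ℝ} (hF : Differentiable ℝ F)
    (hM : Differentiable ℝ M) (a c d u : ℝ) :
    deriv (fun v => c * M v + d * (a * v - F v)) u = c * deriv M u + d * (a - deriv F u) := by
  have h := ((hM u).hasDerivAt.const_mul c).fun_add
    ((((hasDerivAt_id u).const_mul a).sub (hF u).hasDerivAt).const_mul d)
  simpa using h.deriv

/-- The explicit functions `Γ₁, Γ₂, Γ₃` of the 3×3 BGK model satisfy
the defining relations of Theorem 3.1:
`Γᵢ′(u) = gᵢ Mᵢ′(u) + (ρ/2)(hᵢ⁻¹ (a − F′(u)) + (λᵢ − a) Mᵢ′(u))` with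
`(λ₁, λ₂, λ₃) = (−λ, 0, λ)`, `h₁⁻¹ = (α−a)/(2λ)`, `h₂⁻¹ = (λ−α)/λ`,
`h₃⁻¹ = (α+a)/(2λ)`. -/
theorem stmt_18 (F γ : ℝ → ℝ) (hF : Differentiable ℝ F) (hγ : Differentiable ℝ γ)
    (hγ' : ∀ u, deriv γ u = |deriv F u|)
    (β l a : ℝ) (hβ : β ∈ Set.Ioo (0 : ℝ) 1) (hl : 0 < l)
    (ha : a ≠ 0) (hla : l ≠ a) (hla' : l ≠ -a)
    (α : ℝ) (hα : α = a + β * l)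
    (M₁ M₂ M₃ : ℝ → ℝ)
    (hM₁ : M₁ = fun u => (1 / 2) * ((γ u - F u) / l + β * u))
    (hM₃ : M₃ = fun u => (1 / 2) * ((γ u + F u) / l + β * u))
    (hM₂ : M₂ = fun u => (1 - β) * u - γ u / l)
    (ρ : ℝ)
    (g₁ g₂ g₃ : ℝ)
    (hg₁ : g₁ = l * (1 - ρ * α) / (2 * (l + a)) + ρ * (l + a) / 2)
    (hg₂ : g₂ = -(ρ * (l * α - a ^ 2)) / (2 * a))
    (hg₃ : g₃ = -(l * (1 - ρ * α)) / (2 * (l - a)) - ρ * (l - a) / 2)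
    (Γ₁ Γ₂ Γ₃ : ℝ → ℝ)
    (hΓ₁ : Γ₁ = fun u => (l * (1 - ρ * α) / (2 * (l + a))) * M₁ u
        + (ρ * (α - a) / (4 * l)) * (a * u - F u))
    (hΓ₂ : Γ₂ = fun u => -(ρ * l * α / (2 * a)) * M₂ u
        + (ρ * (l - α) / (2 * l)) * (a * u - F u))
    (hΓ₃ : Γ₃ = fun u => -(l * (1 - ρ * α) / (2 * (l - a))) * M₃ u
        + (ρ * (α + a) / (4 * l)) * (a * u - F u)) :
    ∀ u,
      deriv Γ₁ u = g₁ * deriv M₁ u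
          + (ρ / 2) * (((α - a) / (2 * l)) * (a - deriv F u) + (-l - a) * deriv M₁ u) ∧
      deriv Γ₂ u = g₂ * deriv M₂ u
          + (ρ / 2) * (((l - α) / l) * (a - deriv F u) + (0 - a) * deriv M₂ u) ∧
      deriv Γ₃ u = g₃ * deriv M₃ u
          + (ρ / 2) * (((α + a) / (2 * l)) * (a - deriv F u) + (l - a) * deriv M₃ u) := by
  have hM₁d : Differentiable ℝ M₁ := by rw [hM₁]; fun_prop
  have hM₂d : Differentiable ℝ M₂ := by rw [hM₂]; fun_prop
  have hM₃d : Differentiable ℝ M₃ := by rw [hM₃]; fun_prop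
  have hl₀ : l ≠ 0 := hl.ne'
  have hadd : l + a ≠ 0 := fun h => hla' (eq_neg_of_add_eq_zero_left h)
  have hsub : l - a ≠ 0 := sub_ne_zero.mpr hla
  intro u
  refine ⟨?_, ?_, ?_⟩
  · rw [hΓ₁, deriv_const_mul_add_const_mul_linear_sub hF hM₁d, hg₁]
    field_simp
    ring
  · rw [hΓ₂, deriv_const_mul_add_const_mul_linear_sub hF hM₂d, hg₂]
    field_simp
    ring
  · rw [hΓ₃, deriv_const_mul_add_const_mul_linear_sub hF hM₃d, hg₃]
    field_simp
    ring
end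

section
/- Let a > 0, β ∈ (0, 1), λ > 0, set α = a + βλ and assume α ≤ λ. Let F(u) = a(u − u²), let γ be differentiable with γ′ = |F′|, and M₂(u) = (1 − β)u − γ(u)/λ. Let Δx > 0, ρ > 0, Δt = ρΔx, and Γ₂′(u) = −(ρλα/(2a)) M₂′(u) + (ρ(λ − α)/(2λ))(a − F′(u)). If ρ ≤ 2a/(aΔx + λα), then for all u ∈ [0, 1]: M₂′(u)(1 − Δt/2) + Γ₂′(u) ≥ M₂′(u)(1 − Δt/2 − ρλα/(2a)) ≥ 0. -/
/-- The 'second case' inequality in the proof of the monotonicity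
Proposition 5.2: if `ρ ≤ 2a/(aΔx + λα)` then for all `u ∈ [0,1]`,
`M₂′(u)(1 − Δt/2) + Γ₂′(u) ≥ M₂′(u)(1 − Δt/2 − ρλα/(2a)) ≥ 0`. -/
theorem stmt_19 (a β l : ℝ) (ha : 0 < a) (hβ : β ∈ Set.Ioo (0 : ℝ) 1) (hl : 0 < l)
    (α : ℝ) (hα : α = a + β * l) (hαl : α ≤ l)
    (F γ : ℝ → ℝ) (hF : F = fun u => a * (u - u ^ 2))
    (hγ : Differentiable ℝ γ) (hγ' : ∀ u, deriv γ u = |deriv F u|)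
    (M₂ : ℝ → ℝ) (hM₂ : M₂ = fun u => (1 - β) * u - γ u / l)
    (Δx ρ Δt : ℝ) (hΔx : 0 < Δx) (hρ : 0 < ρ) (hΔt : Δt = ρ * Δx)
    (G₂ : ℝ → ℝ)
    (hG₂ : G₂ = fun u => -(ρ * l * α / (2 * a)) * deriv M₂ u
        + (ρ * (l - α) / (2 * l)) * (a - deriv F u))
    (hρle : ρ ≤ 2 * a / (a * Δx + l * α)) :
    ∀ u ∈ Set.Icc (0 : ℝ) 1,
      deriv M₂ u * (1 - Δt / 2 - ρ * l * α / (2 * a)) ≤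
        deriv M₂ u * (1 - Δt / 2) + G₂ u ∧
      0 ≤ deriv M₂ u * (1 - Δt / 2 - ρ * l * α / (2 * a)) := by
  obtain ⟨hβ0, -⟩ := hβ
  have hα0 : 0 < α := by rw [hα]; positivity
  have hF' (u : ℝ) : deriv F u = a * (1 - 2 * u) := by
    rw [hF]
    simp
  have hM₂' (u : ℝ) : deriv M₂ u = (1 - β) - |deriv F u| / l := by
    rw [hM₂, ← hγ' u]
    exact ((hasDerivAt_const_mul (1 - β)).sub ((hγ u).hasDerivAt.div_const l)).deriv
  intro u ⟨hu0, hu1⟩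
  have habs : |deriv F u| ≤ a := by
    rw [hF', abs_le]
    constructor <;> nlinarith
  have hM₂_nonneg : 0 ≤ deriv M₂ u := by
    rw [hM₂', sub_nonneg, div_le_iff₀ hl]
    linarith
  have hfactor : 0 ≤ 1 - Δt / 2 - ρ * l * α / (2 * a) := by
    rw [le_div_iff₀ (by positivity)] at hρle
    have h : 1 - Δt / 2 - ρ * l * α / (2 * a) =
        (2 * a - ρ * (a * Δx + l * α)) / (2 * a) := by
      rw [hΔt]
      field_simp
      ring
    rw [h]
    exact div_nonneg (by linarith) (by positivity)
  have hflux : 0 ≤ ρ * (l - α) / (2 * l) * (a - deriv F u) :=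
    mul_nonneg (div_nonneg (mul_nonneg hρ.le (sub_nonneg.2 hαl)) (by positivity))
      (sub_nonneg.2 ((le_abs_self _).trans habs))
  refine ⟨?_, mul_nonneg hM₂_nonneg hfactor⟩
  simp only [hG₂]
  linarith
end
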